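/- arXiv:1901.00214 — 2 statements merged into one kernel-verified Lean document; each statement's English description precedes it below -/
import Mathlib

section
/- Let (x_t, C_t) be the sequence of cluster centers and clusterings generated by the NK-means algorithm with step size α satisfying 0 < α < d_min/((1/ρ)N* + λ_M(L)). Then, with c(α) = 2α(d_min − α((1/ρ)N* + λ_M(L))) > 0, for every t one has J^ρ(x_{t+1}, C_{t+1}) ≤ J^ρ(x_t, C_t) − c(α) ‖x_t − μ_{t+1}‖², where μ_{t+1} = (μ_m^k(t+1))_{m,k} is the stacked vector of the targets in the center update. -/
open scoped BigOperators

noncomputable section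

/-! ### Basic (centralized) K-means notions -/

/-- The dataset `D` contains at least `K` distinct points. -/
def HasKDistinct {p : ℕ} (K : ℕ) (D : Multiset (EuclideanSpace ℝ (Fin p))) : Prop :=
  ∃ S : Finset (EuclideanSpace ℝ (Fin p)), S.card = K ∧ ∀ y ∈ S, y ∈ D

/-- The K-means clustering cost `F(x) = ∑_{y ∈ D} min_k ‖y - x^k‖²`. -/
def kmeansF {p : ℕ} (K : ℕ) (D : Multiset (EuclideanSpace ℝ (Fin p)))
    (x : Fin K → EuclideanSpace ℝ (Fin p)) : ℝ :=
  (D.map fun y => ⨅ k : Fin K, ‖y - x k‖ ^ 2).sum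

/-- `P` is a partition of the multiset `D` into `K` (possibly empty) cells. -/
def IsKPartition {p K : ℕ} (D : Multiset (EuclideanSpace ℝ (Fin p)))
    (P : Fin K → Multiset (EuclideanSpace ℝ (Fin p))) : Prop :=
  ∑ k, P k = D

/-- The distortion cost `H(x, P) = ∑_k ∑_{y ∈ P^k} ‖y - x^k‖²`. -/
def costH {p K : ℕ} (x : Fin K → EuclideanSpace ℝ (Fin p))
    (P : Fin K → Multiset (EuclideanSpace ℝ (Fin p))) : ℝ :=
  ∑ k, ((P k).map fun y => ‖y - x k‖ ^ 2).sum

/-- `(x, P)` is a Lloyd's minimum for the dataset `D`. -/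
def IsLloydMin {p K : ℕ} (D : Multiset (EuclideanSpace ℝ (Fin p)))
    (x : Fin K → EuclideanSpace ℝ (Fin p))
    (P : Fin K → Multiset (EuclideanSpace ℝ (Fin p))) : Prop :=
  IsKPartition D P ∧
    (∀ Q, IsKPartition D Q → costH x P ≤ costH x Q) ∧
    (∀ x', costH x P ≤ costH x' P)

/-- The set `Z` of Lloyd's minima (cluster-center tuples). -/
def LloydZ {p : ℕ} (K : ℕ) (D : Multiset (EuclideanSpace ℝ (Fin p))) :
    Set (Fin K → EuclideanSpace ℝ (Fin p)) :=
  {x | ∃ P, IsLloydMin D x P}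

/-- The set `Z̄` of Lloyd's minima whose centers lie in the (closed) convex hull of `D`. -/
def LloydZbar {p : ℕ} (K : ℕ) (D : Multiset (EuclideanSpace ℝ (Fin p))) :
    Set (Fin K → EuclideanSpace ℝ (Fin p)) :=
  {x ∈ LloydZ K D | ∀ k, x k ∈ convexHull ℝ {y | y ∈ D}}

/-- The set `Z_g` of global minimizers of the K-means cost `F`. -/
def kmeansZg {p : ℕ} (K : ℕ) (D : Multiset (EuclideanSpace ℝ (Fin p))) :
    Set (Fin K → EuclideanSpace ℝ (Fin p)) :=
  {x | ∀ x', kmeansF K D x ≤ kmeansF K D x'}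

/-- The global minimum value `F*` of the K-means cost. -/
def Fstar {p : ℕ} (K : ℕ) (D : Multiset (EuclideanSpace ℝ (Fin p))) : ℝ :=
  sInf (Set.range (kmeansF K D))

/-- `R₀ = max{‖v‖ : v ∈ closed convex hull of D}`. -/
def R0 {p : ℕ} (D : Multiset (EuclideanSpace ℝ (Fin p))) : ℝ :=
  sSup ((fun v => ‖v‖) '' convexHull ℝ {y | y ∈ D})

/-! ### Multi-agent notions -/

section Distributed

variable {p K M : ℕ}

/-- The multi-agent cost `J^ρ(x, C)`; each undirected edge is counted once in the
agreement term. -/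
def costJ (ρ : ℝ) (G : SimpleGraph (Fin M)) [DecidableRel G.Adj]
    (x : Fin M → Fin K → EuclideanSpace ℝ (Fin p))
    (C : Fin M → Fin K → Multiset (EuclideanSpace ℝ (Fin p))) : ℝ :=
  (1 / ρ) * ∑ m, ∑ k, ((C m k).map fun y => ‖y - x m k‖ ^ 2).sum +
    (1 / 2) * ∑ m, ∑ l ∈ G.neighborFinset m, ∑ k, ‖x m k - x l k‖ ^ 2

/-- The multi-agent cost `Q^ρ(x)`. -/
def costQ (ρ : ℝ) (G : SimpleGraph (Fin M)) [DecidableRel G.Adj]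
    (Dm : Fin M → Multiset (EuclideanSpace ℝ (Fin p)))
    (x : Fin M → Fin K → EuclideanSpace ℝ (Fin p)) : ℝ :=
  (1 / ρ) * ∑ m, ((Dm m).map fun y => ⨅ k : Fin K, ‖y - x m k‖ ^ 2).sum +
    (1 / 2) * ∑ m, ∑ l ∈ G.neighborFinset m, ∑ k, ‖x m k - x l k‖ ^ 2

/-- The set of global minimizers `M^ρ_g` of `Q^ρ`. -/
def globQ (ρ : ℝ) (G : SimpleGraph (Fin M)) [DecidableRel G.Adj]
    (Dm : Fin M → Multiset (EuclideanSpace ℝ (Fin p))) (K : ℕ) :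
    Set (Fin M → Fin K → EuclideanSpace ℝ (Fin p)) :=
  {x | ∀ x' : Fin M → Fin K → EuclideanSpace ℝ (Fin p), costQ ρ G Dm x ≤ costQ ρ G Dm x'}

/-- `C ∈ U_x` : `C` is an admissible (Voronoi / nearest-center) clustering for `x`. -/
def InVoronoi (Dm : Fin M → Multiset (EuclideanSpace ℝ (Fin p)))
    (x : Fin M → Fin K → EuclideanSpace ℝ (Fin p))
    (C : Fin M → Fin K → Multiset (EuclideanSpace ℝ (Fin p))) : Prop :=
  (∀ m, IsKPartition (Dm m) (C m)) ∧
    ∀ m k y, y ∈ C m k → ∀ k', ‖y - x m k‖ ≤ ‖y - x m k'‖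

/-- The fixed-point (stationarity) equations
`((1/ρ)|C_m^k| + |Ω_m|) x_m^k = (1/ρ) ∑_{y ∈ C_m^k} y + ∑_{l ∈ Ω_m} x_l^k`. -/
def IsFixedCenters (ρ : ℝ) (G : SimpleGraph (Fin M)) [DecidableRel G.Adj]
    (x : Fin M → Fin K → EuclideanSpace ℝ (Fin p))
    (C : Fin M → Fin K → Multiset (EuclideanSpace ℝ (Fin p))) : Prop :=
  ∀ m k, ((1 / ρ) * ((C m k).card : ℝ) + (G.degree m : ℝ)) • x m k =
      (1 / ρ) • (C m k).sum + ∑ l ∈ G.neighborFinset m, x l k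

/-- `(x, C)` is a generalized Lloyd's minimum of `J^ρ`. -/
def IsGenLloydMin (ρ : ℝ) (G : SimpleGraph (Fin M)) [DecidableRel G.Adj]
    (Dm : Fin M → Multiset (EuclideanSpace ℝ (Fin p)))
    (x : Fin M → Fin K → EuclideanSpace ℝ (Fin p))
    (C : Fin M → Fin K → Multiset (EuclideanSpace ℝ (Fin p))) : Prop :=
  InVoronoi Dm x C ∧ IsFixedCenters ρ G x C

/-- The set `M^ρ` of generalized Lloyd's minima (centers part). -/
def genM (ρ : ℝ) (G : SimpleGraph (Fin M)) [DecidableRel G.Adj]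
    (Dm : Fin M → Multiset (EuclideanSpace ℝ (Fin p))) (K : ℕ) :
    Set (Fin M → Fin K → EuclideanSpace ℝ (Fin p)) :=
  {x | ∃ C, IsGenLloydMin ρ G Dm x C}

/-- The set `M̄^ρ` of generalized Lloyd's minima with all centers in the (closed)
convex hull of the collective dataset `D`. -/
def genMbar (ρ : ℝ) (G : SimpleGraph (Fin M)) [DecidableRel G.Adj]
    (Dm : Fin M → Multiset (EuclideanSpace ℝ (Fin p)))
    (D : Multiset (EuclideanSpace ℝ (Fin p))) (K : ℕ) :
    Set (Fin M → Fin K → EuclideanSpace ℝ (Fin p)) :=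
  {x ∈ genM ρ G Dm K | ∀ m k, x m k ∈ convexHull ℝ {y | y ∈ D}}

/-- The update target
`μ_m^k = ((1/ρ) ∑_{y ∈ C_m^k} y + ∑_{l ∈ Ω_m} x_l^k) / ((1/ρ)|C_m^k| + |Ω_m|)`. -/
def muVec (ρ : ℝ) (G : SimpleGraph (Fin M)) [DecidableRel G.Adj]
    (x : Fin M → Fin K → EuclideanSpace ℝ (Fin p))
    (C : Fin M → Fin K → Multiset (EuclideanSpace ℝ (Fin p)))
    (m : Fin M) (k : Fin K) : EuclideanSpace ℝ (Fin p) :=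
  ((1 / ρ) * ((C m k).card : ℝ) + (G.degree m : ℝ))⁻¹ •
    ((1 / ρ) • (C m k).sum + ∑ l ∈ G.neighborFinset m, x l k)

/-- `(x_t, C_t)` is a trajectory of the NK-means algorithm with parameters `ρ, α`. -/
def NKMeansSeq (ρ α : ℝ) (G : SimpleGraph (Fin M)) [DecidableRel G.Adj]
    (Dm : Fin M → Multiset (EuclideanSpace ℝ (Fin p)))
    (x : ℕ → Fin M → Fin K → EuclideanSpace ℝ (Fin p))
    (C : ℕ → Fin M → Fin K → Multiset (EuclideanSpace ℝ (Fin p))) : Prop :=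
  (∀ m, IsKPartition (Dm m) (C 0 m)) ∧
    ∀ t, (∀ m, IsKPartition (Dm m) (C (t + 1) m)) ∧
      (∀ m k y, y ∈ C (t + 1) m k → ∀ k', ‖y - x t m k‖ ≤ ‖y - x t m k'‖) ∧
      ∀ m k, x (t + 1) m k = x t m k - α • (x t m k - muVec ρ G (x t) (C (t + 1)) m k)

/-- The minimum vertex degree `d_min` of the communication graph. -/
def minDeg (G : SimpleGraph (Fin M)) [DecidableRel G.Adj] : ℕ :=
  sInf (Set.range fun m : Fin M => G.degree m)

/-- The largest eigenvalue `λ_M(L)` of the graph Laplacian. -/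
def lapLamMax (G : SimpleGraph (Fin M)) [DecidableRel G.Adj] : ℝ :=
  sSup (spectrum ℝ (G.lapMatrix ℝ))

/-- The second-smallest eigenvalue `λ₂(L)` of the graph Laplacian (for a connected
graph, the smallest nonzero eigenvalue). -/
def lapLam2 (G : SimpleGraph (Fin M)) [DecidableRel G.Adj] : ℝ :=
  sInf {μ : ℝ | μ ∈ spectrum ℝ (G.lapMatrix ℝ) ∧ μ ≠ 0}

/-- `N* = max_m |D_m|`. -/
def Nstar (Dm : Fin M → Multiset (EuclideanSpace ℝ (Fin p))) : ℕ :=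
  Finset.univ.sup fun m => (Dm m).card

/-- The step-size condition `0 < α < d_min / ((1/ρ) N* + λ_M(L))`. -/
def StepOK (ρ α : ℝ) (G : SimpleGraph (Fin M)) [DecidableRel G.Adj]
    (Dm : Fin M → Multiset (EuclideanSpace ℝ (Fin p))) : Prop :=
  0 < α ∧ α * ((1 / ρ) * (Nstar Dm : ℝ) + lapLamMax G) < (minDeg G : ℝ)

/-- The constant `c(α) = 2α(d_min − α((1/ρ)N* + λ_M(L)))`. -/
def cAlpha (ρ α : ℝ) (G : SimpleGraph (Fin M)) [DecidableRel G.Adj]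
    (Dm : Fin M → Multiset (EuclideanSpace ℝ (Fin p))) : ℝ :=
  2 * α * ((minDeg G : ℝ) - α * ((1 / ρ) * (Nstar Dm : ℝ) + lapLamMax G))

end Distributed

theorem Multiset.map_finsetSum {ι β γ : Type*} (s : Finset ι) (f : ι → Multiset β) (g : β → γ) :
    (∑ i ∈ s, f i).map g = ∑ i ∈ s, (f i).map g :=
  map_sum (Multiset.mapAddMonoidHom g) f s

/-- Among all `K`-cell partitions, a nearest-center one minimizes the distortion cost. -/
theorem costH_le_of_nearest {p K : ℕ} {D : Multiset (EuclideanSpace ℝ (Fin p))}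
    {P Q : Fin K → Multiset (EuclideanSpace ℝ (Fin p))}
    (hP : IsKPartition D P) (hQ : IsKPartition D Q) (x : Fin K → EuclideanSpace ℝ (Fin p))
    (h : ∀ k y, y ∈ P k → ∀ k', ‖y - x k‖ ≤ ‖y - x k'‖) : costH x P ≤ costH x Q := by
  let f : EuclideanSpace ℝ (Fin p) → ℝ := fun y => ⨅ k, ‖y - x k‖ ^ 2
  have hsum : ∀ R : Fin K → Multiset (EuclideanSpace ℝ (Fin p)), IsKPartition D R →
      ∑ k, ((R k).map f).sum = (D.map f).sum := by
    intro R hR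
    rw [← hR, Multiset.map_finsetSum]
    exact (map_sum Multiset.sumAddMonoidHom _ _).symm
  have hle : ∀ y k, f y ≤ ‖y - x k‖ ^ 2 := fun y k => ciInf_le (Set.finite_range _).bddBelow k
  calc costH x P ≤ ∑ k, ((P k).map f).sum := by
        refine Finset.sum_le_sum fun k _ => Multiset.sum_map_le_sum_map _ _ fun y hy => ?_
        have : Nonempty (Fin K) := ⟨k⟩
        exact le_ciInf fun k' => pow_le_pow_left₀ (norm_nonneg _) (h k y hy k') 2
    _ = ∑ k, ((Q k).map f).sum := (hsum P hP).trans (hsum Q hQ).symm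
    _ ≤ costH x Q :=
        Finset.sum_le_sum fun k _ => Multiset.sum_map_le_sum_map _ _ fun y _ => hle y k

open scoped Matrix in
theorem Matrix.IsHermitian.dotProduct_mulVec_le_sSup_spectrum {n : Type*} [Fintype n]
    [DecidableEq n] {A : Matrix n n ℝ} (hA : A.IsHermitian) (u : n → ℝ) :
    u ⬝ᵥ (A *ᵥ u) ≤ sSup (spectrum ℝ A) * (u ⬝ᵥ u) := by
  set r := sSup (spectrum ℝ A)
  have hps : (algebraMap ℝ (Matrix n n ℝ) r - A).PosSemidef := by
    rw [Matrix.posSemidef_iff_isHermitian_and_spectrum_nonneg]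
    refine ⟨Matrix.IsHermitian.sub ?_ hA, ?_⟩
    · rw [Matrix.algebraMap_eq_diagonal]
      exact Matrix.isHermitian_diagonal _
    · rw [← spectrum.singleton_sub_eq]
      rintro _ ⟨_, rfl, a, ha, rfl⟩
      exact sub_nonneg.2 (le_csSup (Matrix.finite_real_spectrum (A := A)).bddAbove ha)
  have h := hps.dotProduct_mulVec_nonneg u
  rw [Matrix.sub_mulVec, dotProduct_sub, Algebra.algebraMap_eq_smul_one, Matrix.smul_mulVec,
    Matrix.one_mulVec, dotProduct_smul, star_trivial, smul_eq_mul] at h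
  linarith

section Laplacian

variable {M : ℕ} (G : SimpleGraph (Fin M)) [DecidableRel G.Adj]

theorem lapLamMax_nonneg : 0 ≤ lapLamMax G :=
  Real.sSup_nonneg fun _ ha =>
    (Matrix.posSemidef_iff_isHermitian_and_spectrum_nonneg.1 (G.posSemidef_lapMatrix ℝ)).2 ha

theorem sum_sq_sub_le_lapLamMax (u : Fin M → ℝ) :
    1 / 2 * ∑ m, ∑ l ∈ G.neighborFinset m, (u m - u l) ^ 2 ≤ lapLamMax G * ∑ m, u m ^ 2 := by
  have h := (G.posSemidef_lapMatrix ℝ).isHermitian.dotProduct_mulVec_le_sSup_spectrum u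
  rw [← Matrix.toLinearMap₂'_apply', SimpleGraph.lapMatrix_toLinearMap₂'] at h
  simp only [SimpleGraph.neighborFinset_eq_filter, Finset.sum_filter]
  simp only [dotProduct, ← pow_two] at h
  rw [lapLamMax]
  linarith

theorem sum_norm_sq_sub_le_lapLamMax {p : ℕ} (v : Fin M → EuclideanSpace ℝ (Fin p)) :
    1 / 2 * ∑ m, ∑ l ∈ G.neighborFinset m, ‖v m - v l‖ ^ 2 ≤ lapLamMax G * ∑ m, ‖v m‖ ^ 2 := by
  have h := Finset.sum_le_sum fun i (_ : i ∈ (Finset.univ : Finset (Fin p))) =>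
    sum_sq_sub_le_lapLamMax G fun m => v m i
  simp only [← Finset.mul_sum] at h
  simp only [EuclideanSpace.real_norm_sq_eq, PiLp.sub_apply]
  rw [Finset.sum_comm (s := Finset.univ (α := Fin M)) (t := Finset.univ (α := Fin p))]
  refine le_of_eq_of_le (congrArg _ ?_) h
  rw [Finset.sum_comm]
  exact Finset.sum_congr rfl fun m _ => Finset.sum_comm

variable {E : Type*} [NormedAddCommGroup E] [InnerProductSpace ℝ E]

theorem sum_neighborFinset_comm (f : Fin M → Fin M → ℝ) :
    ∑ m, ∑ l ∈ G.neighborFinset m, f m l = ∑ m, ∑ l ∈ G.neighborFinset m, f l m := by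
  simp only [SimpleGraph.neighborFinset_eq_filter, Finset.sum_filter]
  rw [Finset.sum_comm]
  simp only [G.adj_comm]

theorem sum_norm_sq_sub_smul (x v : Fin M → E) (α : ℝ) :
    1 / 2 * ∑ m, ∑ l ∈ G.neighborFinset m, ‖(x m - α • v m) - (x l - α • v l)‖ ^ 2 =
      1 / 2 * ∑ m, ∑ l ∈ G.neighborFinset m, ‖x m - x l‖ ^ 2
        - 2 * α * ∑ m, inner ℝ (∑ l ∈ G.neighborFinset m, (x m - x l)) (v m)
        + α ^ 2 * (1 / 2 * ∑ m, ∑ l ∈ G.neighborFinset m, ‖v m - v l‖ ^ 2) := by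
  have hexp : ∀ m l, ‖(x m - α • v m) - (x l - α • v l)‖ ^ 2 = ‖x m - x l‖ ^ 2
      - 2 * α * (inner ℝ (x m - x l) (v m) + inner ℝ (x l - x m) (v l))
      + α ^ 2 * ‖v m - v l‖ ^ 2 := by
    intro m l
    rw [show (x m - α • v m) - (x l - α • v l) = (x m - x l) - α • (v m - v l) by module,
      norm_sub_sq_real, inner_smul_right, norm_smul, mul_pow, Real.norm_eq_abs, sq_abs,
      inner_sub_right, ← neg_sub (x m) (x l), inner_neg_left]
    ring
  have hsymm := sum_neighborFinset_comm G fun m l => inner ℝ (x l - x m) (v l)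
  simp only [sum_inner]
  simp only [hexp, Finset.sum_add_distrib, Finset.sum_sub_distrib, ← Finset.mul_sum]
  rw [hsymm]
  ring

end Laplacian

theorem Multiset.sum_norm_sq_sub_smul {E : Type*} [NormedAddCommGroup E] [InnerProductSpace ℝ E]
    (S : Multiset E) (x v : E) (α : ℝ) :
    (S.map fun y => ‖y - (x - α • v)‖ ^ 2).sum = (S.map fun y => ‖y - x‖ ^ 2).sum
      - 2 * α * inner ℝ ((S.card : ℝ) • x - S.sum) v + α ^ 2 * (S.card * ‖v‖ ^ 2) := by
  induction S using Multiset.induction_on with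
  | empty => simp
  | cons y S ih =>
    rw [Multiset.map_cons, Multiset.sum_cons, ih, Multiset.map_cons, Multiset.sum_cons,
      Multiset.sum_cons, Multiset.card_cons, show y - (x - α • v) = (y - x) + α • v by module,
      norm_add_sq_real, inner_smul_right, norm_smul, mul_pow, Real.norm_eq_abs, sq_abs]
    push_cast
    rw [show ((S.card : ℝ) + 1) • x - (y + S.sum) = ((S.card : ℝ) • x - S.sum) - (y - x) by module,
      inner_sub_left _ (y - x)]
    ring

section Descent

variable {p K M : ℕ} (ρ α : ℝ) (G : SimpleGraph (Fin M)) [DecidableRel G.Adj]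
  (x v : Fin M → Fin K → EuclideanSpace ℝ (Fin p))
  (C : Fin M → Fin K → Multiset (EuclideanSpace ℝ (Fin p)))

theorem sum_agreement_comm (z : Fin M → Fin K → EuclideanSpace ℝ (Fin p)) :
    1 / 2 * ∑ m, ∑ l ∈ G.neighborFinset m, ∑ k, ‖z m k - z l k‖ ^ 2 =
      ∑ k, 1 / 2 * ∑ m, ∑ l ∈ G.neighborFinset m, ‖z m k - z l k‖ ^ 2 := by
  rw [← Finset.mul_sum, Finset.sum_comm]
  exact congrArg _ (Finset.sum_congr rfl fun m _ => Finset.sum_comm)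

/-- Second-order expansion of the multi-agent cost in the centers. -/
theorem costJ_sub_smul :
    costJ ρ G (fun m k => x m k - α • v m k) C = costJ ρ G x C
      - 2 * α * ∑ m, ∑ k, inner ℝ ((1 / ρ) • (((C m k).card : ℝ) • x m k - (C m k).sum)
          + ∑ l ∈ G.neighborFinset m, (x m k - x l k)) (v m k)
      + α ^ 2 * ((1 / ρ) * ∑ m, ∑ k, (C m k).card * ‖v m k‖ ^ 2
          + 1 / 2 * ∑ m, ∑ l ∈ G.neighborFinset m, ∑ k, ‖v m k - v l k‖ ^ 2) := by
  have hcomm : ∑ k, ∑ m, inner ℝ (∑ l ∈ G.neighborFinset m, (x m k - x l k)) (v m k) =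
      ∑ m, ∑ k, inner ℝ (∑ l ∈ G.neighborFinset m, (x m k - x l k)) (v m k) := Finset.sum_comm
  have hagree : 1 / 2 * ∑ m, ∑ l ∈ G.neighborFinset m, ∑ k,
        ‖(x m k - α • v m k) - (x l k - α • v l k)‖ ^ 2 =
      1 / 2 * ∑ m, ∑ l ∈ G.neighborFinset m, ∑ k, ‖x m k - x l k‖ ^ 2
        - 2 * α * ∑ m, ∑ k, inner ℝ (∑ l ∈ G.neighborFinset m, (x m k - x l k)) (v m k)
        + α ^ 2 * (1 / 2 * ∑ m, ∑ l ∈ G.neighborFinset m, ∑ k, ‖v m k - v l k‖ ^ 2) := by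
    rw [sum_agreement_comm G (fun m k => x m k - α • v m k), sum_agreement_comm G x,
      sum_agreement_comm G v, ← hcomm, Finset.mul_sum, Finset.mul_sum (a := α ^ 2),
      ← Finset.sum_sub_distrib, ← Finset.sum_add_distrib]
    exact Finset.sum_congr rfl fun k _ =>
      sum_norm_sq_sub_smul G (fun m => x m k) (fun m => v m k) α
  simp only [costJ]
  rw [hagree]
  simp only [Multiset.sum_norm_sq_sub_smul, inner_add_left, inner_smul_left, RCLike.conj_to_real,
    Finset.sum_add_distrib, Finset.sum_sub_distrib, ← Finset.mul_sum]
  ring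

theorem smul_sub_muVec {m : Fin M} {k : Fin K}
    (hw : (1 / ρ) * ((C m k).card : ℝ) + (G.degree m : ℝ) ≠ 0) :
    ((1 / ρ) * ((C m k).card : ℝ) + (G.degree m : ℝ)) • (x m k - muVec ρ G x C m k) =
      (1 / ρ) • (((C m k).card : ℝ) • x m k - (C m k).sum)
        + ∑ l ∈ G.neighborFinset m, (x m k - x l k) := by
  rw [muVec, smul_sub, smul_inv_smul₀ hw, Finset.sum_sub_distrib, Finset.sum_const,
    G.card_neighborFinset_eq_degree, ← Nat.cast_smul_eq_nsmul ℝ]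
  module

theorem costJ_le_of_nearest {Dm : Fin M → Multiset (EuclideanSpace ℝ (Fin p))}
    {C' : Fin M → Fin K → Multiset (EuclideanSpace ℝ (Fin p))} (hρ : 0 < ρ)
    (hC : InVoronoi Dm x C) (hC' : ∀ m, IsKPartition (Dm m) (C' m)) :
    costJ ρ G x C ≤ costJ ρ G x C' := by
  have h := Finset.sum_le_sum fun m (_ : m ∈ Finset.univ) =>
    costH_le_of_nearest (hC.1 m) (hC' m) (x m) (hC.2 m)
  exact add_le_add_left (mul_le_mul_of_nonneg_left h (by positivity)) _

theorem card_le_Nstar {Dm : Fin M → Multiset (EuclideanSpace ℝ (Fin p))} {m : Fin M}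
    (hC : IsKPartition (Dm m) (C m)) (k : Fin K) : (C m k).card ≤ Nstar Dm := by
  refine le_trans ?_ (Finset.le_sup (f := fun m => (Dm m).card) (Finset.mem_univ m))
  rw [← hC]
  exact Multiset.card_le_card (Finset.single_le_sum (f := C m) (fun _ _ => zero_le)
    (Finset.mem_univ k))

/-- Decrease of the cost in one center update at a fixed clustering. -/
theorem costJ_center_update_le {Dm : Fin M → Multiset (EuclideanSpace ℝ (Fin p))} (hρ : 0 < ρ)
    (hα : StepOK ρ α G Dm) (hC : ∀ m, IsKPartition (Dm m) (C m)) :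
    costJ ρ G (fun m k => x m k - α • (x m k - muVec ρ G x C m k)) C ≤ costJ ρ G x C -
      cAlpha ρ α G Dm * ∑ m, ∑ k, ‖x m k - muVec ρ G x C m k‖ ^ 2 := by
  obtain ⟨hα0, hα1⟩ := hα
  have hlam := lapLamMax_nonneg G
  have hB : 0 ≤ (1 / ρ) * (Nstar Dm : ℝ) + lapLamMax G := by positivity
  have hdmin : (0 : ℝ) < minDeg G := lt_of_le_of_lt (by positivity) hα1
  have hdeg : ∀ m, (minDeg G : ℝ) ≤ G.degree m := fun m =>
    Nat.cast_le.2 (Nat.sInf_le ⟨m, rfl⟩)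
  have hw : ∀ m k, (minDeg G : ℝ) ≤ (1 / ρ) * ((C m k).card : ℝ) + (G.degree m : ℝ) := fun m k =>
    (hdeg m).trans (le_add_of_nonneg_left (by positivity))
  set v : Fin M → Fin K → EuclideanSpace ℝ (Fin p) := fun m k => x m k - muVec ρ G x C m k
  set V := ∑ m, ∑ k, ‖v m k‖ ^ 2 with hV
  have hV0 : 0 ≤ V := by positivity
  have hgrad : minDeg G * V ≤
      ∑ m, ∑ k, inner ℝ ((1 / ρ) • (((C m k).card : ℝ) • x m k - (C m k).sum)
          + ∑ l ∈ G.neighborFinset m, (x m k - x l k)) (v m k) := by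
    simp only [hV, Finset.mul_sum]
    refine Finset.sum_le_sum fun m _ => Finset.sum_le_sum fun k _ => ?_
    rw [← smul_sub_muVec ρ G x C (hdmin.trans_le (hw m k)).ne', inner_smul_left,
      RCLike.conj_to_real, real_inner_self_eq_norm_sq]
    exact mul_le_mul_of_nonneg_right (hw m k) (by positivity)
  have hcard : ∑ m, ∑ k, (C m k).card * ‖v m k‖ ^ 2 ≤ Nstar Dm * V := by
    simp only [hV, Finset.mul_sum]
    refine Finset.sum_le_sum fun m _ => Finset.sum_le_sum fun k _ => ?_
    exact mul_le_mul_of_nonneg_right (Nat.cast_le.2 (card_le_Nstar C (hC m) k)) (by positivity)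
  have hagree : 1 / 2 * ∑ m, ∑ l ∈ G.neighborFinset m, ∑ k, ‖v m k - v l k‖ ^ 2 ≤
      lapLamMax G * V := by
    rw [sum_agreement_comm, hV, Finset.sum_comm, Finset.mul_sum]
    exact Finset.sum_le_sum fun k _ => sum_norm_sq_sub_le_lapLamMax G fun m => v m k
  have hquad : (1 / ρ) * ∑ m, ∑ k, (C m k).card * ‖v m k‖ ^ 2
      + 1 / 2 * ∑ m, ∑ l ∈ G.neighborFinset m, ∑ k, ‖v m k - v l k‖ ^ 2 ≤
      ((1 / ρ) * Nstar Dm + lapLamMax G) * V := by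
    have := mul_le_mul_of_nonneg_left hcard (by positivity : 0 ≤ 1 / ρ)
    linarith
  rw [costJ_sub_smul ρ α G x v C, cAlpha]
  have h1 := mul_le_mul_of_nonneg_left hgrad (by positivity : 0 ≤ 2 * α)
  have h2 := mul_le_mul_of_nonneg_left hquad (by positivity : 0 ≤ α ^ 2)
  have h3 : 0 ≤ α ^ 2 * (((1 / ρ) * Nstar Dm + lapLamMax G) * V) := by positivity
  linarith

end Descent

/-- Lemma 1, monotone cost improvement for `J^ρ`: along any NK-means
trajectory, with `c(α) = 2α(d_min − α((1/ρ)N* + λ_M(L))) > 0`,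
`J^ρ(x_{t+1}, C_{t+1}) ≤ J^ρ(x_t, C_t) − c(α) ‖x_t − μ_{t+1}‖²`. -/
theorem stmt8 {p K M : ℕ}
    (Dm : Fin M → Multiset (EuclideanSpace ℝ (Fin p)))
    (G : SimpleGraph (Fin M)) [DecidableRel G.Adj] (hconn : G.Connected)
    (ρ α : ℝ) (hρ : 0 < ρ) (hα : StepOK ρ α G Dm)
    (x : ℕ → Fin M → Fin K → EuclideanSpace ℝ (Fin p))
    (C : ℕ → Fin M → Fin K → Multiset (EuclideanSpace ℝ (Fin p)))
    (hseq : NKMeansSeq ρ α G Dm x C) :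
    0 < cAlpha ρ α G Dm ∧
      ∀ t, costJ ρ G (x (t + 1)) (C (t + 1)) ≤ costJ ρ G (x t) (C t) -
        cAlpha ρ α G Dm * ∑ m, ∑ k, ‖x t m k - muVec ρ G (x t) (C (t + 1)) m k‖ ^ 2 := by
  refine ⟨mul_pos (mul_pos two_pos hα.1) (sub_pos.2 hα.2), fun t => ?_⟩
  obtain ⟨h0, hstep⟩ := hseq
  obtain ⟨hpart, hnear, hupd⟩ := hstep t
  have hprev : ∀ m, IsKPartition (Dm m) (C t m) := by
    cases t with
    | zero => exact h0
    | succ t => exact (hstep t).1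
  rw [funext₂ hupd]
  exact (costJ_center_update_le ρ α G (x t) (C (t + 1)) hρ hα hpart).trans
    (sub_le_sub_right (costJ_le_of_nearest ρ G (x t) _ hρ ⟨hpart, hnear⟩ hprev) _)
end
end

section
/- Let the dataset contain at least K distinct points, the communication graph be connected, and the step size satisfy 0 < α < d_min/((1/ρ)N* + λ_M(L)). Then any limit point x̆ of the sequence of cluster centers (x_t) generated by the NK-means algorithm is a generalized Lloyd's minimum, i.e. there exists C ∈ ℂ_1×…×ℂ_M such that (x̆, C) is a generalized Lloyd's minimum of J^ρ (equivalently, Ū_x̆ ≠ ∅). -/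
open scoped BigOperators

noncomputable section

namespace SimpleGraph

variable {V : Type*} [Fintype V] (G : SimpleGraph V) [DecidableRel G.Adj]

theorem sum_neighborFinset_swap {β : Type*} [AddCommMonoid β] (f : V → V → β) :
    ∑ m, ∑ l ∈ G.neighborFinset m, f m l = ∑ m, ∑ l ∈ G.neighborFinset m, f l m :=
  Finset.sum_comm' fun m l => by simp [G.adj_comm]

theorem half_sum_norm_sub_sq_step {E : Type*} [NormedAddCommGroup E] [InnerProductSpace ℝ E]
    (x v : V → E) (α : ℝ) :
    (1 / 2) * ∑ m, ∑ l ∈ G.neighborFinset m, ‖(x m - α • v m) - (x l - α • v l)‖ ^ 2 =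
      (1 / 2) * ∑ m, ∑ l ∈ G.neighborFinset m, ‖x m - x l‖ ^ 2
        - 2 * α * ∑ m, inner ℝ (v m) ((G.degree m : ℝ) • x m - ∑ l ∈ G.neighborFinset m, x l)
        + α ^ 2 * ((1 / 2) * ∑ m, ∑ l ∈ G.neighborFinset m, ‖v m - v l‖ ^ 2) := by
  have hterm : ∀ m l, ‖(x m - α • v m) - (x l - α • v l)‖ ^ 2 =
      ‖x m - x l‖ ^ 2 - 2 * α * (inner ℝ (v m) (x m - x l) + inner ℝ (v l) (x l - x m))
        + α ^ 2 * ‖v m - v l‖ ^ 2 := by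
    intro m l
    have h : (x m - α • v m) - (x l - α • v l) = (x m - x l) - α • (v m - v l) := by module
    rw [h, norm_sub_sq_real, inner_smul_right, real_inner_comm, norm_smul, mul_pow,
      Real.norm_eq_abs, sq_abs, inner_sub_left, ← neg_sub (x m) (x l), inner_neg_right]
    ring
  have hlin : ∀ m, inner ℝ (v m) ((G.degree m : ℝ) • x m - ∑ l ∈ G.neighborFinset m, x l) =
      ∑ l ∈ G.neighborFinset m, inner ℝ (v m) (x m - x l) := by
    intro m
    rw [← inner_sum, Finset.sum_sub_distrib, Finset.sum_const, G.card_neighborFinset_eq_degree,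
      Nat.cast_smul_eq_nsmul]
  simp only [hterm, hlin, Finset.sum_add_distrib, Finset.sum_sub_distrib, ← Finset.mul_sum]
  rw [G.sum_neighborFinset_swap fun m l => inner ℝ (v l) (x l - x m)]
  ring

variable [DecidableEq V]

theorem bddAbove_spectrum_lapMatrix : BddAbove (spectrum ℝ (G.lapMatrix ℝ)) :=
  (Matrix.finite_real_spectrum (A := G.lapMatrix ℝ)).bddAbove

theorem sSup_spectrum_lapMatrix_nonneg : 0 ≤ sSup (spectrum ℝ (G.lapMatrix ℝ)) :=
  Real.sSup_nonneg fun _ h =>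
    (Matrix.posSemidef_iff_isHermitian_and_spectrum_nonneg.1 (G.posSemidef_lapMatrix ℝ)).2 h

theorem half_sum_sub_sq_le (w : V → ℝ) :
    (1 / 2) * ∑ m, ∑ l ∈ G.neighborFinset m, (w m - w l) ^ 2 ≤
      sSup (spectrum ℝ (G.lapMatrix ℝ)) * ∑ m, w m ^ 2 := by
  set s := sSup (spectrum ℝ (G.lapMatrix ℝ)) with hs
  have hpsd : (algebraMap ℝ (Matrix V V ℝ) s - G.lapMatrix ℝ).PosSemidef := by
    refine Matrix.posSemidef_iff_isHermitian_and_spectrum_nonneg.2 ⟨?_, ?_⟩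
    · refine Matrix.IsHermitian.sub ?_ (G.posSemidef_lapMatrix ℝ).1
      rw [Algebra.algebraMap_eq_smul_one]
      simp [Matrix.IsHermitian]
    · rw [← spectrum.singleton_sub_eq]
      rintro _ ⟨_, rfl, a, ha, rfl⟩
      exact sub_nonneg.2 (le_csSup G.bddAbove_spectrum_lapMatrix ha)
  have h := hpsd.dotProduct_mulVec_nonneg w
  have hL := G.lapMatrix_toLinearMap₂' ℝ w
  rw [Matrix.toLinearMap₂'_apply'] at hL
  rw [Matrix.sub_mulVec, dotProduct_sub, Algebra.algebraMap_eq_smul_one, Matrix.smul_mulVec,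
    Matrix.one_mulVec, dotProduct_smul, star_trivial, hL] at h
  have h2 : ∑ m, ∑ l ∈ G.neighborFinset m, (w m - w l) ^ 2 =
      ∑ i, ∑ j, if G.Adj i j then (w i - w j) ^ 2 else 0 := by
    simp [neighborFinset_eq_filter, Finset.sum_filter]
  have h3 : w ⬝ᵥ w = ∑ m, w m ^ 2 := by simp [dotProduct, sq]
  rw [h3, smul_eq_mul] at h
  rw [h2]
  linarith

theorem half_sum_norm_sub_sq_le {p : ℕ} (v : V → EuclideanSpace ℝ (Fin p)) :
    (1 / 2) * ∑ m, ∑ l ∈ G.neighborFinset m, ‖v m - v l‖ ^ 2 ≤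
      sSup (spectrum ℝ (G.lapMatrix ℝ)) * ∑ m, ‖v m‖ ^ 2 := by
  have hcoord : ∑ m, ∑ l ∈ G.neighborFinset m, ‖v m - v l‖ ^ 2 =
      ∑ i, ∑ m, ∑ l ∈ G.neighborFinset m, (v m i - v l i) ^ 2 := by
    simp only [EuclideanSpace.real_norm_sq_eq, PiLp.sub_apply]
    rw [Finset.sum_comm (s := (Finset.univ : Finset (Fin p)))]
    exact Finset.sum_congr rfl fun m _ => Finset.sum_comm
  have hnorm : ∑ m, ‖v m‖ ^ 2 = ∑ i, ∑ m, v m i ^ 2 := by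
    simp only [EuclideanSpace.real_norm_sq_eq]
    exact Finset.sum_comm
  rw [hcoord, hnorm, Finset.mul_sum, Finset.mul_sum]
  exact Finset.sum_le_sum fun i _ => G.half_sum_sub_sq_le fun m => v m i

end SimpleGraph

theorem Multiset.sum_map_norm_sub_sq_step {E : Type*} [NormedAddCommGroup E]
    [InnerProductSpace ℝ E] (s : Multiset E) (x v : E) (α : ℝ) :
    (s.map fun y => ‖y - (x - α • v)‖ ^ 2).sum =
      (s.map fun y => ‖y - x‖ ^ 2).sum - 2 * α * inner ℝ v ((s.card : ℝ) • x - s.sum)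
        + α ^ 2 * (s.card * ‖v‖ ^ 2) := by
  induction s using Multiset.induction with
  | empty => simp
  | cons y s ih =>
    have h : y - (x - α • v) = (y - x) + α • v := by module
    simp only [Multiset.map_cons, Multiset.sum_cons, Multiset.card_cons, ih]
    rw [h, norm_add_sq_real, inner_smul_right, real_inner_comm, norm_smul, mul_pow,
      Real.norm_eq_abs, sq_abs]
    push_cast
    simp only [inner_sub_right, inner_add_right, inner_smul_right]
    ring

section KMeans

variable {p K M : ℕ}

theorem IsKPartition.le {D : Multiset (EuclideanSpace ℝ (Fin p))}
    {P : Fin K → Multiset (EuclideanSpace ℝ (Fin p))} (hP : IsKPartition D P) (k : Fin K) :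
    P k ≤ D :=
  hP ▸ Finset.single_le_sum (f := P) (fun _ _ => Multiset.zero_le _) (Finset.mem_univ k)

theorem IsKPartition.sum_map {D : Multiset (EuclideanSpace ℝ (Fin p))}
    {P : Fin K → Multiset (EuclideanSpace ℝ (Fin p))} (hP : IsKPartition D P)
    (f : EuclideanSpace ℝ (Fin p) → ℝ) : (D.map f).sum = ∑ k, ((P k).map f).sum := by
  rw [← hP, ← Multiset.coe_mapAddMonoidHom, map_sum, ← Multiset.coe_sumAddMonoidHom, map_sum]

theorem costQ_nonneg {ρ : ℝ} (hρ : 0 < ρ) (G : SimpleGraph (Fin M)) [DecidableRel G.Adj]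
    (Dm : Fin M → Multiset (EuclideanSpace ℝ (Fin p)))
    (x : Fin M → Fin K → EuclideanSpace ℝ (Fin p)) : 0 ≤ costQ ρ G Dm x := by
  refine add_nonneg (mul_nonneg (by positivity) (Finset.sum_nonneg fun m _ => ?_)) (by positivity)
  refine Multiset.sum_nonneg fun a ha => ?_
  obtain ⟨y, -, rfl⟩ := Multiset.mem_map.1 ha
  exact Real.iInf_nonneg fun k => by positivity

theorem costQ_le_costJ {ρ : ℝ} (hρ : 0 < ρ) (G : SimpleGraph (Fin M)) [DecidableRel G.Adj]
    {Dm : Fin M → Multiset (EuclideanSpace ℝ (Fin p))}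
    (x : Fin M → Fin K → EuclideanSpace ℝ (Fin p))
    {C : Fin M → Fin K → Multiset (EuclideanSpace ℝ (Fin p))}
    (hC : ∀ m, IsKPartition (Dm m) (C m)) : costQ ρ G Dm x ≤ costJ ρ G x C := by
  unfold costQ costJ
  gcongr with m
  rw [(hC m).sum_map]
  gcongr with k
  exact Multiset.sum_map_le_sum_map _ _ fun y _ => ciInf_le (Set.finite_range _).bddBelow k

theorem InVoronoi.costJ_le_costQ {ρ : ℝ} (hρ : 0 < ρ) (G : SimpleGraph (Fin M))
    [DecidableRel G.Adj] {Dm : Fin M → Multiset (EuclideanSpace ℝ (Fin p))}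
    {x : Fin M → Fin K → EuclideanSpace ℝ (Fin p)}
    {C : Fin M → Fin K → Multiset (EuclideanSpace ℝ (Fin p))}
    (hC : InVoronoi Dm x C) : costJ ρ G x C ≤ costQ ρ G Dm x := by
  unfold costQ costJ
  gcongr with m
  rw [(hC.1 m).sum_map]
  gcongr with k
  refine Multiset.sum_map_le_sum_map _ _ fun y hy => ?_
  have : Nonempty (Fin K) := ⟨k⟩
  exact le_ciInf fun k' => by gcongr; exact hC.2 m k y hy k'

theorem costJ_step (ρ α : ℝ) (G : SimpleGraph (Fin M)) [DecidableRel G.Adj]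
    (x v : Fin M → Fin K → EuclideanSpace ℝ (Fin p))
    (C : Fin M → Fin K → Multiset (EuclideanSpace ℝ (Fin p))) :
    costJ ρ G (fun m k => x m k - α • v m k) C =
      costJ ρ G x C
        - 2 * α * ∑ m, ∑ k, inner ℝ (v m k)
          (((1 / ρ) * ((C m k).card : ℝ) + (G.degree m : ℝ)) • x m k -
            ((1 / ρ) • (C m k).sum + ∑ l ∈ G.neighborFinset m, x l k))
        + α ^ 2 * ((1 / ρ) * ∑ m, ∑ k, (C m k).card * ‖v m k‖ ^ 2 +
          ∑ k, (1 / 2) * ∑ m, ∑ l ∈ G.neighborFinset m, ‖v m k - v l k‖ ^ 2) := by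
  have hswap : ∀ z : Fin M → Fin K → EuclideanSpace ℝ (Fin p),
      (1 / 2) * ∑ m, ∑ l ∈ G.neighborFinset m, ∑ k, ‖z m k - z l k‖ ^ 2 =
        ∑ k, (1 / 2) * ∑ m, ∑ l ∈ G.neighborFinset m, ‖z m k - z l k‖ ^ 2 := by
    intro z
    rw [← Finset.mul_sum, Finset.sum_comm (s := (Finset.univ : Finset (Fin K)))]
    congr 1
    exact Finset.sum_congr rfl fun m _ => Finset.sum_comm
  have hinner : ∀ m k, inner ℝ (v m k)
      (((1 / ρ) * ((C m k).card : ℝ) + (G.degree m : ℝ)) • x m k -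
        ((1 / ρ) • (C m k).sum + ∑ l ∈ G.neighborFinset m, x l k)) =
      (1 / ρ) * inner ℝ (v m k) (((C m k).card : ℝ) • x m k - (C m k).sum) +
        inner ℝ (v m k) ((G.degree m : ℝ) • x m k - ∑ l ∈ G.neighborFinset m, x l k) := by
    intro m k
    simp only [inner_sub_right, inner_add_right, inner_smul_right]
    ring
  unfold costJ
  rw [hswap, hswap x]
  simp only [Multiset.sum_map_norm_sub_sq_step, hinner]
  rw [Finset.sum_congr rfl fun k _ =>
    G.half_sum_norm_sub_sq_step (fun m => x m k) (fun m => v m k) α]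
  simp only [Finset.sum_add_distrib, Finset.sum_sub_distrib, ← Finset.mul_sum]
  rw [Finset.sum_comm (s := (Finset.univ : Finset (Fin K))) (f := fun k m =>
    inner ℝ (v m k) ((G.degree m : ℝ) • x m k - ∑ l ∈ G.neighborFinset m, x l k))]
  ring

theorem minDeg_le_degree (G : SimpleGraph (Fin M)) [DecidableRel G.Adj] (m : Fin M) :
    minDeg G ≤ G.degree m :=
  Nat.sInf_le ⟨m, rfl⟩

theorem StepOK.minDeg_pos {ρ α : ℝ} (hρ : 0 < ρ) {G : SimpleGraph (Fin M)} [DecidableRel G.Adj]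
    {Dm : Fin M → Multiset (EuclideanSpace ℝ (Fin p))} (h : StepOK ρ α G Dm) :
    (0 : ℝ) < minDeg G := by
  have hlam : 0 ≤ lapLamMax G := G.sSup_spectrum_lapMatrix_nonneg
  have := h.1
  exact lt_of_le_of_lt (by positivity) h.2

theorem weight_pos {ρ : ℝ} (hρ : 0 < ρ) {G : SimpleGraph (Fin M)} [DecidableRel G.Adj]
    (hpos : (0 : ℝ) < minDeg G) (n : ℕ) (m : Fin M) :
    0 < (1 / ρ) * (n : ℝ) + (G.degree m : ℝ) := by
  have : (minDeg G : ℝ) ≤ G.degree m := by exact_mod_cast minDeg_le_degree G m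
  have : 0 ≤ (1 / ρ) * (n : ℝ) := by positivity
  linarith

theorem weight_smul_sub_muVec {ρ : ℝ} {G : SimpleGraph (Fin M)} [DecidableRel G.Adj]
    (x : Fin M → Fin K → EuclideanSpace ℝ (Fin p))
    (C : Fin M → Fin K → Multiset (EuclideanSpace ℝ (Fin p))) (m : Fin M) (k : Fin K)
    (hw : 0 < (1 / ρ) * ((C m k).card : ℝ) + (G.degree m : ℝ)) :
    ((1 / ρ) * ((C m k).card : ℝ) + (G.degree m : ℝ)) • x m k -
        ((1 / ρ) • (C m k).sum + ∑ l ∈ G.neighborFinset m, x l k) =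
      ((1 / ρ) * ((C m k).card : ℝ) + (G.degree m : ℝ)) • (x m k - muVec ρ G x C m k) := by
  rw [smul_sub, muVec, smul_inv_smul₀ hw.ne']

/-- One step of the algorithm decreases the cost `Q^ρ` by at least
`α d_min` times the squared length of the displacement. -/
theorem InVoronoi.costQ_step_le {ρ α : ℝ} (hρ : 0 < ρ) {G : SimpleGraph (Fin M)}
    [DecidableRel G.Adj] {Dm : Fin M → Multiset (EuclideanSpace ℝ (Fin p))}
    (hα : StepOK ρ α G Dm) {x : Fin M → Fin K → EuclideanSpace ℝ (Fin p)}
    {C : Fin M → Fin K → Multiset (EuclideanSpace ℝ (Fin p))} (hC : InVoronoi Dm x C) :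
    costQ ρ G Dm (fun m k => x m k - α • (x m k - muVec ρ G x C m k)) ≤
      costQ ρ G Dm x - α * minDeg G * ∑ m, ∑ k, ‖x m k - muVec ρ G x C m k‖ ^ 2 := by
  set v : Fin M → Fin K → EuclideanSpace ℝ (Fin p) := fun m k => x m k - muVec ρ G x C m k with hv
  have hα0 := hα.1
  set S := ∑ m, ∑ k, ‖v m k‖ ^ 2 with hS
  have hS0 : 0 ≤ S := by positivity
  have h1 := (costQ_le_costJ hρ G (fun m k => x m k - α • v m k) hC.1)
  have h2 := hC.costJ_le_costQ hρ G
  rw [costJ_step] at h1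
  have hlin : minDeg G * S ≤ ∑ m, ∑ k, inner ℝ (v m k)
      (((1 / ρ) * ((C m k).card : ℝ) + (G.degree m : ℝ)) • x m k -
        ((1 / ρ) • (C m k).sum + ∑ l ∈ G.neighborFinset m, x l k)) := by
    simp only [hS, Finset.mul_sum]
    gcongr with m _ k _
    rw [weight_smul_sub_muVec x C m k (weight_pos hρ (hα.minDeg_pos hρ) _ m), inner_smul_right,
      real_inner_self_eq_norm_sq]
    gcongr
    have : (minDeg G : ℝ) ≤ G.degree m := by exact_mod_cast minDeg_le_degree G m
    have : 0 ≤ (1 / ρ) * ((C m k).card : ℝ) := by positivity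
    linarith
  have hcard : ∑ m, ∑ k, (C m k).card * ‖v m k‖ ^ 2 ≤ Nstar Dm * S := by
    simp only [hS, Finset.mul_sum]
    gcongr with m _ k _
    exact (Multiset.card_le_card ((hC.1 m).le k)).trans
      (Finset.le_sup (f := fun m => (Dm m).card) (Finset.mem_univ m))
  have hlap : ∑ k, (1 / 2) * ∑ m, ∑ l ∈ G.neighborFinset m, ‖v m k - v l k‖ ^ 2 ≤
      lapLamMax G * S := by
    rw [hS, Finset.sum_comm, Finset.mul_sum]
    exact Finset.sum_le_sum fun k _ => G.half_sum_norm_sub_sq_le fun m => v m k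
  have hquad : α ^ 2 * ((1 / ρ) * ∑ m, ∑ k, (C m k).card * ‖v m k‖ ^ 2 +
      ∑ k, (1 / 2) * ∑ m, ∑ l ∈ G.neighborFinset m, ‖v m k - v l k‖ ^ 2) ≤
      α * minDeg G * S := by
    calc _ ≤ α ^ 2 * ((1 / ρ) * (Nstar Dm * S) + lapLamMax G * S) := by gcongr
      _ = α * S * (α * ((1 / ρ) * Nstar Dm + lapLamMax G)) := by ring
      _ ≤ α * S * minDeg G := by gcongr; exact hα.2.le
      _ = α * minDeg G * S := by ring
  have := mul_le_mul_of_nonneg_left hlin (by positivity : 0 ≤ 2 * α)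
  linarith

end KMeans

open Filter Topology in
theorem tendsto_zero_of_descent {Q a : ℕ → ℝ} {c : ℝ} (hc : 0 < c) (hQ : ∀ t, 0 ≤ Q t)
    (ha : ∀ t, 0 ≤ a t) (h : ∀ t, Q (t + 1) ≤ Q t - c * a t) : Tendsto a atTop (𝓝 0) := by
  have hanti : Antitone Q := antitone_nat_of_succ_le fun t => by
    linarith [h t, mul_nonneg hc.le (ha t)]
  have hlim := tendsto_atTop_ciInf hanti ⟨0, by rintro _ ⟨t, rfl⟩; exact hQ t⟩
  have hdiff : Tendsto (fun t => (Q t - Q (t + 1)) / c) atTop (𝓝 0) := by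
    simpa using (hlim.sub (hlim.comp (tendsto_add_atTop_nat 1))).div_const c
  refine squeeze_zero ha (fun t => ?_) hdiff
  rw [le_div_iff₀ hc]
  linarith [h t]

open Filter in
theorem exists_frequently_eq_of_finite {ι β : Type*} {l : Filter ι} [l.NeBot] {f : ι → β}
    {s : Set β} (hs : s.Finite) (hf : ∀ i, f i ∈ s) : ∃ b, ∃ᶠ i in l, f i = b := by
  by_contra! h
  have h2 : ∀ᶠ i in l, ∀ b ∈ s, f i ≠ b :=
    (eventually_all_finite hs).2 fun b _ => h b
  obtain ⟨i, hi⟩ := h2.exists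
  exact hi _ (hf i) rfl

/-- Lemma 3: every limit point of the sequence of centers generated
by the NK-means algorithm is a generalized Lloyd's minimum. -/
theorem stmt12 {p K M : ℕ} (hK2 : 2 ≤ K)
    (Dm : Fin M → Multiset (EuclideanSpace ℝ (Fin p)))
    (D : Multiset (EuclideanSpace ℝ (Fin p))) (hD : ∑ m, Dm m = D)
    (hdistinct : HasKDistinct K D)
    (G : SimpleGraph (Fin M)) [DecidableRel G.Adj] (hconn : G.Connected)
    (ρ α : ℝ) (hρ : 0 < ρ) (hα : StepOK ρ α G Dm)
    (x : ℕ → Fin M → Fin K → EuclideanSpace ℝ (Fin p))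
    (C : ℕ → Fin M → Fin K → Multiset (EuclideanSpace ℝ (Fin p)))
    (hseq : NKMeansSeq ρ α G Dm x C)
    (xb : Fin M → Fin K → EuclideanSpace ℝ (Fin p))
    (hlim : ∃ φ : ℕ → ℕ, StrictMono φ ∧
      Filter.Tendsto (fun s => x (φ s)) Filter.atTop (nhds xb)) :
    ∃ Cb : Fin M → Fin K → Multiset (EuclideanSpace ℝ (Fin p)),
      IsGenLloydMin ρ G Dm xb Cb := by
  obtain ⟨φ, hφ, hx⟩ := hlim
  have hpos := hα.minDeg_pos hρ
  have hvor : ∀ t, InVoronoi Dm (x t) (C (t + 1)) := fun t => ⟨(hseq.2 t).1, (hseq.2 t).2.1⟩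
  have hstep : ∀ t, x (t + 1) =
      fun m k => x t m k - α • (x t m k - muVec ρ G (x t) (C (t + 1)) m k) :=
    fun t => funext fun m => funext fun k => (hseq.2 t).2.2 m k
  have hsum := tendsto_zero_of_descent (Q := fun t => costQ ρ G Dm (x t))
    (a := fun t => ∑ m, ∑ k, ‖x t m k - muVec ρ G (x t) (C (t + 1)) m k‖ ^ 2)
    (mul_pos hα.1 hpos) (fun t => costQ_nonneg hρ G Dm (x t)) (fun t => by positivity)
    (fun t => by
      have h := (hvor t).costQ_step_le hρ hα
      rwa [← hstep t] at h)
  have hmove : ∀ m k, Filter.Tendsto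
      (fun s => x (φ s) m k - muVec ρ G (x (φ s)) (C (φ s + 1)) m k) Filter.atTop (nhds 0) := by
    intro m k
    rw [tendsto_zero_iff_norm_tendsto_zero]
    have hsq : Filter.Tendsto
        (fun t => ‖x t m k - muVec ρ G (x t) (C (t + 1)) m k‖ ^ 2) Filter.atTop (nhds 0) := by
      refine squeeze_zero (fun t => by positivity) (fun t => ?_) hsum
      refine (Finset.single_le_sum (f := fun k =>
        ‖x t m k - muVec ρ G (x t) (C (t + 1)) m k‖ ^ 2) (fun _ _ => by positivity)
        (Finset.mem_univ k)).trans ?_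
      exact Finset.single_le_sum (f := fun m => ∑ k,
        ‖x t m k - muVec ρ G (x t) (C (t + 1)) m k‖ ^ 2) (fun _ _ => by positivity)
        (Finset.mem_univ m)
    simpa [Function.comp_def, Real.sqrt_sq] using (hsq.sqrt).comp hφ.tendsto_atTop
  have hfin : (Set.univ.pi fun m : Fin M => Set.univ.pi fun _ : Fin K =>
      Set.Iic (Dm m)).Finite :=
    Set.Finite.pi fun m => Set.Finite.pi fun _ => Set.finite_Iic (Dm m)
  obtain ⟨Cb, hCb⟩ := exists_frequently_eq_of_finite (l := Filter.atTop)
    (f := fun s => C (φ s + 1)) hfin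
    (fun s m _ k _ => ((hvor (φ s)).1 m).le k)
  set l : Filter ℕ := Filter.atTop ⊓ Filter.principal {s | C (φ s + 1) = Cb} with hl
  have : l.NeBot := Filter.frequently_mem_iff_neBot.1 hCb
  have hev : ∀ᶠ s in l, C (φ s + 1) = Cb := Filter.mem_inf_of_right (Filter.mem_principal_self _)
  have hxl : ∀ m k, Filter.Tendsto (fun s => x (φ s) m k) l (nhds (xb m k)) := fun m k =>
    ((hx.apply_nhds m).apply_nhds k).mono_left inf_le_left
  refine ⟨Cb, ⟨fun m => ?_, fun m k y hy k' => ?_⟩, fun m k => ?_⟩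
  · obtain ⟨s, hs⟩ := hCb.exists
    exact hs ▸ (hvor (φ s)).1 m
  · refine le_of_tendsto_of_tendsto (tendsto_const_nhds.sub (hxl m k)).norm
      (tendsto_const_nhds.sub (hxl m k')).norm ?_
    filter_upwards [hev] with s hs
    exact (hvor (φ s)).2 m k y (hs ▸ hy) k'
  · rw [← sub_eq_zero]
    have hw := weight_pos hρ hpos (Cb m k).card m
    have hzero := ((hmove m k).mono_left (inf_le_left : l ≤ _)).const_smul
      ((1 / ρ) * ((Cb m k).card : ℝ) + (G.degree m : ℝ))
    rw [smul_zero] at hzero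
    refine tendsto_nhds_unique (((hxl m k).const_smul _).sub
      (tendsto_const_nhds.add (tendsto_finsetSum _ fun l _ => hxl l k))) (hzero.congr' ?_)
    filter_upwards [hev] with s hs
    rw [hs, weight_smul_sub_muVec _ _ m k hw]
end
end
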